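/- arXiv:1901.04887 — 2 statements merged into one kernel-verified Lean document; each statement's English description precedes it below -/
import Mathlib

section
/- Let X be a quasiregular topological space and let κ = L(X)·wt(X). If λ is a cardinal that is a caliber of X and satisfies κ < λ ≤ (2^κ)⁺, then d(X) ≤ 2^κ. -/
open Cardinal Set Topology
universe u
noncomputable section

/-- The tightness of a space: the least infinite cardinal `τ` such that whenever
`y ∈ closure A` there is `B ⊆ A` with `#B ≤ τ` and `y ∈ closure B`. -/
def tightness (Y : Type u) [TopologicalSpace Y] : Cardinal.{u} :=
  sInf {τ : Cardinal.{u} | ℵ₀ ≤ τ ∧ ∀ (A : Set Y) (y : Y), y ∈ closure A →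
    ∃ B ⊆ A, #B ≤ τ ∧ y ∈ closure B}

/-- The `μ`-closure of a set `A`: the union of the closures of all subsets of `A`
of cardinality at most `μ`. -/
def kClosure {X : Type u} [TopologicalSpace X] (μ : Cardinal.{u}) (A : Set X) : Set X :=
  ⋃ B ∈ {B : Set X | B ⊆ A ∧ #B ≤ μ}, closure B

/-- `𝒞` witnesses that the weak tightness of `X` is at most `κ`. -/
def IsWeakTightnessWitness (X : Type u) [TopologicalSpace X] (κ : Cardinal.{u})
    (𝒞 : Set (Set X)) : Prop :=
  ⋃₀ 𝒞 = Set.univ ∧ #𝒞 ≤ 2 ^ κ ∧ ∀ C ∈ 𝒞, tightness C ≤ κ ∧ kClosure (2 ^ κ) C = Set.univ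

/-- The weak tightness of `X`: the least infinite cardinal `κ` for which there is a
cover `𝒞` of `X` with `#𝒞 ≤ 2^κ` such that each `C ∈ 𝒞` has tightness at most `κ`
and `X = cl_{2^κ} C`. -/
def weakTightness (X : Type u) [TopologicalSpace X] : Cardinal.{u} :=
  sInf {κ : Cardinal.{u} | ℵ₀ ≤ κ ∧ ∃ 𝒞 : Set (Set X), IsWeakTightnessWitness X κ 𝒞}

/-- The π-character of a point `x`: the least cardinality of a family of nonempty
open sets such that every neighborhood of `x` contains a member of the family. -/
def piCharacterAt {X : Type u} [TopologicalSpace X] (x : X) : Cardinal.{u} :=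
  sInf {c : Cardinal.{u} | ∃ 𝒰 : Set (Set X), #𝒰 = c ∧
    (∀ U ∈ 𝒰, IsOpen U ∧ U.Nonempty) ∧ ∀ N ∈ nhds x, ∃ U ∈ 𝒰, U ⊆ N}

/-- The π-character of a space: the supremum of the π-characters at its points
(at least `ℵ₀`). -/
def piCharacter (X : Type u) [TopologicalSpace X] : Cardinal.{u} :=
  max ℵ₀ (⨆ x : X, piCharacterAt x)

/-- The Lindelöf degree: the least infinite cardinal `κ` such that every open cover
has a subcover of cardinality at most `κ`. -/
def lindelofDegree (X : Type u) [TopologicalSpace X] : Cardinal.{u} :=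
  sInf {κ : Cardinal.{u} | ℵ₀ ≤ κ ∧ ∀ 𝒰 : Set (Set X), (∀ U ∈ 𝒰, IsOpen U) →
    ⋃₀ 𝒰 = Set.univ → ∃ 𝒱 ⊆ 𝒰, #𝒱 ≤ κ ∧ ⋃₀ 𝒱 = Set.univ}

/-- The density of `X`: the least infinite cardinality of a dense subset. -/
def density (X : Type u) [TopologicalSpace X] : Cardinal.{u} :=
  sInf {c : Cardinal.{u} | ℵ₀ ≤ c ∧ ∃ D : Set X, Dense D ∧ #D ≤ c}

/-- The pseudocharacter of a subset `F` of `X`: the least infinite cardinality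
of a family of open sets whose intersection is `F`. -/
def setPseudoCharacter {X : Type u} [TopologicalSpace X] (F : Set X) : Cardinal.{u} :=
  sInf {κ : Cardinal.{u} | ℵ₀ ≤ κ ∧ ∃ 𝒰 : Set (Set X), #𝒰 ≤ κ ∧
    (∀ U ∈ 𝒰, IsOpen U) ∧ ⋂₀ 𝒰 = F}

/-- The pseudocharacter of a space: the least infinite `κ` such that every singleton
is the intersection of at most `κ` open sets. -/
def pseudoCharacter (X : Type u) [TopologicalSpace X] : Cardinal.{u} :=
  sInf {κ : Cardinal.{u} | ℵ₀ ≤ κ ∧ ∀ x : X, ∃ 𝒰 : Set (Set X), #𝒰 ≤ κ ∧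
    (∀ U ∈ 𝒰, IsOpen U) ∧ ⋂₀ 𝒰 = {x}}

/-- The character of a (closed) set `G` in `X`: the least infinite cardinality of a
family `𝒰` of open sets containing `G` such that every open set containing `G`
contains a member of `𝒰`. -/
def setCharacter {X : Type u} [TopologicalSpace X] (G : Set X) : Cardinal.{u} :=
  sInf {κ : Cardinal.{u} | ℵ₀ ≤ κ ∧ ∃ 𝒰 : Set (Set X), #𝒰 ≤ κ ∧
    (∀ U ∈ 𝒰, IsOpen U ∧ G ⊆ U) ∧ ∀ V : Set X, IsOpen V → G ⊆ V → ∃ U ∈ 𝒰, U ⊆ V}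

/-- A cardinal `λ` is a caliber of `X` if every `λ`-indexed family of nonempty open
sets has a subfamily of cardinality `λ` with nonempty intersection. -/
def IsCaliber (X : Type u) [TopologicalSpace X] (lam : Cardinal.{u}) : Prop :=
  ∀ (ι : Type u) (U : ι → Set X), #ι = lam → (∀ i, IsOpen (U i) ∧ (U i).Nonempty) →
    ∃ J : Set ι, #J = lam ∧ (⋂ i ∈ J, U i).Nonempty

/-- A space is quasiregular if every nonempty open set contains the closure of a
nonempty open set. -/
def Quasiregular (X : Type u) [TopologicalSpace X] : Prop :=
  ∀ U : Set X, IsOpen U → U.Nonempty → ∃ V : Set X, IsOpen V ∧ V.Nonempty ∧ closure V ⊆ U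

/-- The θ-closure of a set `A`. -/
def thetaClosure {X : Type u} [TopologicalSpace X] (A : Set X) : Set X :=
  {x : X | ∀ U : Set X, IsOpen U → x ∈ U → (closure U ∩ A).Nonempty}

/-- The θ-density of `X`: the least infinite cardinality of a θ-dense subset. -/
def thetaDensity (X : Type u) [TopologicalSpace X] : Cardinal.{u} :=
  sInf {c : Cardinal.{u} | ℵ₀ ≤ c ∧ ∃ D : Set X, thetaClosure D = Set.univ ∧ #D ≤ c}

/-- The linear Lindelöf degree: the least infinite cardinal `κ` such that every open
cover totally ordered by inclusion has a subcover of cardinality at most `κ`. -/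
def linearLindelofDegree (X : Type u) [TopologicalSpace X] : Cardinal.{u} :=
  sInf {κ : Cardinal.{u} | ℵ₀ ≤ κ ∧ ∀ 𝒰 : Set (Set X), (∀ U ∈ 𝒰, IsOpen U) →
    IsChain (· ⊆ ·) 𝒰 → ⋃₀ 𝒰 = Set.univ → ∃ 𝒱 ⊆ 𝒰, #𝒱 ≤ κ ∧ ⋃₀ 𝒱 = Set.univ}

/-- The almost Lindelöf degree with respect to closed sets. -/
def almostLindelofDegreeClosed (X : Type u) [TopologicalSpace X] : Cardinal.{u} :=
  sInf {κ : Cardinal.{u} | ℵ₀ ≤ κ ∧ ∀ (F : Set X) (𝒱 : Set (Set X)), IsClosed F →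
    (∀ V ∈ 𝒱, IsOpen V) → F ⊆ ⋃₀ 𝒱 →
    ∃ 𝒱' ⊆ 𝒱, #𝒱' ≤ κ ∧ F ⊆ ⋃ V ∈ 𝒱', closure V}

/-- The closed pseudocharacter of a space. -/
def closedPseudoCharacter (X : Type u) [TopologicalSpace X] : Cardinal.{u} :=
  sInf {κ : Cardinal.{u} | ℵ₀ ≤ κ ∧ ∀ x : X, ∃ 𝒰 : Set (Set X), #𝒰 ≤ κ ∧
    (∀ U ∈ 𝒰, IsOpen U ∧ x ∈ U) ∧ ⋂ U ∈ 𝒰, closure U = {x}}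

section Attained

variable {X : Type u} [TopologicalSpace X]

theorem exists_subset_mem_closure_of_tightness_le {κ : Cardinal.{u}} (h : tightness X ≤ κ)
    {A : Set X} {x : X} (hx : x ∈ closure A) : ∃ B ⊆ A, #B ≤ κ ∧ x ∈ closure B := by
  have hmem : tightness X ∈ {τ : Cardinal.{u} | ℵ₀ ≤ τ ∧ ∀ (A : Set X) (y : X), y ∈ closure A →
      ∃ B ⊆ A, #B ≤ τ ∧ y ∈ closure B} :=
    csInf_mem ⟨max ℵ₀ #X, le_max_left _ _, fun A _ hy =>
      ⟨A, subset_rfl, (mk_set_le A).trans (le_max_right _ _), hy⟩⟩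
  obtain ⟨B, hBA, hB, hxB⟩ := hmem.2 A x hx
  exact ⟨B, hBA, hB.trans h, hxB⟩

variable (X)

theorem lindelofDegree_mem : ℵ₀ ≤ lindelofDegree X ∧ ∀ 𝒰 : Set (Set X), (∀ U ∈ 𝒰, IsOpen U) →
    ⋃₀ 𝒰 = Set.univ → ∃ 𝒱 ⊆ 𝒰, #𝒱 ≤ lindelofDegree X ∧ ⋃₀ 𝒱 = Set.univ :=
  csInf_mem (s := {κ : Cardinal.{u} | ℵ₀ ≤ κ ∧ ∀ 𝒰 : Set (Set X), (∀ U ∈ 𝒰, IsOpen U) →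
      ⋃₀ 𝒰 = Set.univ → ∃ 𝒱 ⊆ 𝒰, #𝒱 ≤ κ ∧ ⋃₀ 𝒱 = Set.univ})
    ⟨max ℵ₀ #(Set X), le_max_left _ _, fun 𝒰 _ h =>
      ⟨𝒰, subset_rfl, (mk_set_le 𝒰).trans (le_max_right _ _), h⟩⟩

theorem weakTightness_mem : ℵ₀ ≤ weakTightness X ∧
    ∃ 𝒞 : Set (Set X), IsWeakTightnessWitness X (weakTightness X) 𝒞 := by
  refine csInf_mem (s := {κ : Cardinal.{u} | ℵ₀ ≤ κ ∧
    ∃ 𝒞 : Set (Set X), IsWeakTightnessWitness X κ 𝒞}) ⟨max ℵ₀ #X, le_max_left _ _, {Set.univ}, ?_⟩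
  refine ⟨sUnion_singleton _, ?_, ?_⟩
  · rw [mk_singleton]
    exact (one_le_aleph0.trans (le_max_left _ _)).trans (cantor _).le
  · rintro C rfl
    refine ⟨csInf_le' ⟨le_max_left _ _, fun A y hy => ⟨A, subset_rfl, ?_, hy⟩⟩, ?_⟩
    · exact ((mk_set_le A).trans mk_univ.le).trans (le_max_right _ _)
    · refine eq_univ_of_forall fun x => mem_biUnion (x := Set.univ) ⟨subset_rfl, ?_⟩
        (subset_closure (mem_univ x))
      exact mk_univ.le.trans ((le_max_right _ _).trans (cantor _).le)

end Attained

theorem Cardinal.mk_biUnion_le_of_le_of_le {ι α : Type u} {m : Cardinal.{u}} (hm : ℵ₀ ≤ m)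
    {s : Set ι} (hs : #s ≤ m) {A : ι → Set α} (hA : ∀ i ∈ s, #(A i) ≤ m) :
    #(⋃ i ∈ s, A i : Set α) ≤ m := by
  have hsup : ⨆ i : s, #(A i) ≤ m := ciSup_le' fun i => hA i i.2
  exact (mk_biUnion_le A s).trans ((mul_le_mul' hs hsup).trans (mul_eq_self hm).le)

theorem IsWeakTightnessWitness.mono {X : Type u} [TopologicalSpace X] {κ μ : Cardinal.{u}}
    {𝒞 : Set (Set X)} (h : IsWeakTightnessWitness X κ 𝒞) (hκμ : κ ≤ μ) :
    IsWeakTightnessWitness X μ 𝒞 := by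
  have hpow : (2 : Cardinal.{u}) ^ κ ≤ 2 ^ μ := power_le_power_left two_ne_zero hκμ
  refine ⟨h.1, h.2.1.trans hpow, fun C hC => ⟨(h.2.2 C hC).1.trans hκμ, ?_⟩⟩
  rw [← univ_subset_iff, ← (h.2.2 C hC).2]
  exact biUnion_mono (fun B hB => ⟨hB.1, hB.2.trans hpow⟩) fun _ _ => subset_rfl

/-- A closed subset covered by open sets `U i`, `i ∈ J`, is covered by at most `L(X)` of them. -/
theorem IsClosed.exists_subcover_le_lindelofDegree {X ι : Type u} [TopologicalSpace X]
    {F : Set X} (hF : IsClosed F) {J : Set ι} {U : ι → Set X} (hU : ∀ i ∈ J, IsOpen (U i))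
    (hcov : F ⊆ ⋃ i ∈ J, U i) :
    ∃ K ⊆ J, #K ≤ lindelofDegree X ∧ F ⊆ ⋃ i ∈ K, U i := by
  obtain ⟨𝒱, h𝒱, hcard, h𝒱cov⟩ := (lindelofDegree_mem X).2 (insert Fᶜ (U '' J))
    (by
      rintro _ (rfl | ⟨i, hi, rfl⟩)
      exacts [hF.isOpen_compl, hU i hi])
    (by
      refine eq_univ_of_forall fun x => ?_
      by_cases hx : x ∈ F
      · obtain ⟨i, hi, hxi⟩ := mem_iUnion₂.1 (hcov hx)
        exact ⟨U i, Or.inr ⟨i, hi, rfl⟩, hxi⟩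
      · exact ⟨Fᶜ, Or.inl rfl, hx⟩)
  obtain ⟨K, hKsub, hK⟩ := exists_subset_bijOn (J ∩ U ⁻¹' 𝒱) U
  refine ⟨K, fun i hi => (hKsub hi).1, ?_, fun x hx => ?_⟩
  · rw [← mk_image_eq_of_injOn U K hK.injOn]
    refine (mk_le_mk_of_subset ?_).trans hcard
    rintro _ ⟨i, hi, rfl⟩
    exact (hKsub hi).2
  · obtain ⟨V, hV, hxV⟩ : x ∈ ⋃₀ 𝒱 := h𝒱cov ▸ mem_univ x
    rcases h𝒱 hV with rfl | ⟨i, hi, rfl⟩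
    · exact absurd hx hxV
    · obtain ⟨k, hk, hki⟩ := hK.surjOn ⟨i, ⟨hi, hV⟩, rfl⟩
      exact mem_biUnion hk (hki ▸ hxV)

/-- `A` is saturated with respect to `𝒞` when `A ∩ C` is dense in `A` for every `C ∈ 𝒞`. -/
def IsSaturated {X : Type u} [TopologicalSpace X] (𝒞 : Set (Set X)) (A : Set X) : Prop :=
  ∀ C ∈ 𝒞, A ⊆ closure (A ∩ C)

section Saturated

variable {X : Type u} [TopologicalSpace X] {𝒞 : Set (Set X)} {κ : Cardinal.{u}}

theorem IsSaturated.biUnion {ι : Type*} {s : Set ι} {A : ι → Set X}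
    (h : ∀ i ∈ s, IsSaturated 𝒞 (A i)) : IsSaturated 𝒞 (⋃ i ∈ s, A i) := fun C hC =>
  iUnion₂_subset fun i hi => (h i hi C hC).trans <|
    closure_mono <| inter_subset_inter_left _ (subset_biUnion_of_mem hi)

theorem IsWeakTightnessWitness.exists_isSaturated (h : IsWeakTightnessWitness X κ 𝒞)
    (hκ : ℵ₀ ≤ κ) (x : X) : ∃ S : Set X, x ∈ S ∧ #S ≤ 2 ^ κ ∧ IsSaturated 𝒞 S := by
  have hκ2 : ℵ₀ ≤ (2 : Cardinal.{u}) ^ κ := hκ.trans (cantor _).le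
  have hB : ∀ (y : X) (C : Set X), ∃ B : Set X, C ∈ 𝒞 → B ⊆ C ∧ #B ≤ 2 ^ κ ∧ y ∈ closure B := by
    intro y C
    by_cases hC : C ∈ 𝒞
    · have hy : y ∈ kClosure (2 ^ κ) C := (h.2.2 C hC).2 ▸ mem_univ y
      obtain ⟨B, hB, hyB⟩ := mem_iUnion₂.1 hy
      exact ⟨B, fun _ => ⟨hB.1, hB.2, hyB⟩⟩
    · exact ⟨∅, fun hC' => absurd hC' hC⟩
  choose B hB using hB
  let E : Set X → Set X := fun A => ⋃ y ∈ A, ⋃ C ∈ 𝒞, B y C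
  have hE : ∀ n : ℕ, #(E^[n] {x}) ≤ 2 ^ κ := by
    intro n
    induction n with
    | zero => simpa using one_le_aleph0.trans hκ2
    | succ n ih =>
      rw [Function.iterate_succ_apply']
      exact mk_biUnion_le_of_le_of_le hκ2 ih fun y _ =>
        mk_biUnion_le_of_le_of_le hκ2 h.2.1 fun C hC => (hB y C hC).2.1
  refine ⟨⋃ n : ULift.{u} ℕ, E^[n.down] {x}, mem_iUnion.2 ⟨⟨0⟩, rfl⟩, ?_, fun C hC y hy => ?_⟩
  · have hsup : ⨆ n : ULift.{u} ℕ, #(E^[n.down] {x}) ≤ 2 ^ κ := ciSup_le' fun n => hE n.down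
    have hnat : #(ULift.{u} ℕ) ≤ 2 ^ κ := by simpa using hκ2
    exact (mk_iUnion_le _).trans ((mul_le_mul' hnat hsup).trans (mul_eq_self hκ2).le)
  · obtain ⟨⟨n⟩, hn⟩ := mem_iUnion.1 hy
    refine closure_mono (subset_inter ?_ (hB y C hC).1) (hB y C hC).2.2
    refine subset_trans ?_ (subset_iUnion _ (⟨n + 1⟩ : ULift.{u} ℕ))
    rw [Function.iterate_succ_apply']
    exact subset_trans (subset_biUnion_of_mem (u := fun C => B y C) hC)
      (subset_biUnion_of_mem (u := fun y => ⋃ C ∈ 𝒞, B y C) hn)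

theorem IsSaturated.exists_subset_mem_closure {A : Set X} (hA : IsSaturated 𝒞 A)
    (h : IsWeakTightnessWitness X κ 𝒞) {x : X} (hx : x ∈ closure A) :
    ∃ B ⊆ A, #B ≤ κ ∧ x ∈ closure B := by
  obtain ⟨C, hC, hxC⟩ : x ∈ ⋃₀ 𝒞 := h.1 ▸ mem_univ x
  have hxAC : x ∈ closure (A ∩ C) := closure_minimal (hA C hC) isClosed_closure hx
  have hmem : (⟨x, hxC⟩ : C) ∈ closure ((↑) ⁻¹' A : Set C) := by
    rwa [closure_subtype, Subtype.image_preimage_coe, inter_comm]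
  obtain ⟨B, hBA, hB, hxB⟩ := exists_subset_mem_closure_of_tightness_le (h.2.2 C hC).1 hmem
  exact ⟨(↑) '' B, image_subset_iff.2 hBA, mk_image_le.trans hB, closure_subtype.1 hxB⟩

end Saturated

/-- A subset of cardinality greater than `κ` of a well order contains such a subset in which all
subsets of cardinality at most `κ` are strictly bounded. -/
theorem exists_subset_forall_bounded {ι : Type u} [LinearOrder ι] [WellFoundedLT ι]
    {κ : Cardinal.{u}} (hκ : ℵ₀ ≤ κ) {J : Set ι} (hJ : κ < #J) :
    ∃ J₀ ⊆ J, ∀ K ⊆ J₀, #K ≤ κ → ∃ j ∈ J₀, ∀ k ∈ K, k < j := by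
  obtain ⟨J₀, hJ₀J, hJ₀, hinit⟩ : ∃ J₀ ⊆ J, κ < #J₀ ∧ ∀ j ∈ J₀, #(J₀ ∩ Iio j : Set ι) ≤ κ := by
    by_cases h : ∃ i, κ < #(J ∩ Iio i : Set ι)
    · obtain ⟨i, hi, hmin⟩ := WellFounded.has_min (wellFounded_lt (α := ι)) _ h
      refine ⟨J ∩ Iio i, inter_subset_left, hi, fun j hj => ?_⟩
      exact (mk_le_mk_of_subset (inter_subset_inter_left _ inter_subset_left)).trans
        (not_lt.1 fun hlt => hmin j hlt hj.2)
    · push Not at h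
      exact ⟨J, subset_rfl, hJ, fun j _ => h j⟩
  refine ⟨J₀, hJ₀J, fun K hKJ hK => ?_⟩
  by_contra! hunb
  refine hJ₀.not_ge (le_trans (mk_le_mk_of_subset fun j hj => ?_)
    (mk_biUnion_le_of_le_of_le hκ hK (A := fun k => insert k (J₀ ∩ Iio k)) fun k hk => ?_))
  · obtain ⟨k, hk, hjk⟩ := hunb j hj
    refine mem_biUnion hk ?_
    rcases hjk.eq_or_lt with rfl | hlt
    exacts [Or.inl rfl, Or.inr ⟨hj, hlt⟩]
  · exact mk_insert_le.trans
      ((add_le_add (hinit k (hKJ hk)) (one_le_aleph0.trans hκ)).trans (add_eq_self hκ).le)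

theorem exists_eq_apply_image_Iio {ι α : Type*} [Preorder ι] [WellFoundedLT ι]
    (g : Set α → α) : ∃ f : ι → α, ∀ i, f i = g (f '' Iio i) := by
  let F : ∀ i : ι, (∀ j : ι, j < i → α) → α := fun i h => g {a | ∃ j, ∃ hj : j < i, h j hj = a}
  refine ⟨wellFounded_lt.fix F, fun i => ?_⟩
  rw [WellFounded.fix_eq]
  change g _ = g _
  congr 1
  ext a
  simp

/-- If `X` is quasiregular, `κ = L(X)·wt(X)`, and `λ` is a caliber of `X`
with `κ < λ ≤ (2^κ)⁺`, then `d(X) ≤ 2^κ`. -/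
theorem density_le_of_caliber (X : Type u) [TopologicalSpace X]
    (hqr : Quasiregular X) (lam : Cardinal.{u}) (hcal : IsCaliber X lam)
    (h1 : lindelofDegree X * weakTightness X < lam)
    (h2 : lam ≤ Order.succ (2 ^ (lindelofDegree X * weakTightness X))) :
    density X ≤ 2 ^ (lindelofDegree X * weakTightness X) := by
  set κ := lindelofDegree X * weakTightness X
  have hL := lindelofDegree_mem X
  obtain ⟨hw, 𝒞, h𝒞⟩ := weakTightness_mem X
  have hLκ : lindelofDegree X ≤ κ := le_mul_right (aleph0_pos.trans_le hw).ne'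
  have hκ : ℵ₀ ≤ κ := hL.1.trans hLκ
  have hκ2 : ℵ₀ ≤ (2 : Cardinal.{u}) ^ κ := hκ.trans (cantor _).le
  replace h𝒞 : IsWeakTightnessWitness X κ 𝒞 := h𝒞.mono (le_mul_left (aleph0_pos.trans_le hL.1).ne')
  by_contra hd
  have hnd : ∀ D : Set X, #D ≤ 2 ^ κ → ¬ Dense D := fun D hD hdense =>
    hd (csInf_le' ⟨hκ2, D, hdense, hD⟩)
  have : Nonempty X := by
    by_contra hX
    exact hnd ∅ (by simp) fun x => absurd ⟨x⟩ hX
  choose S hxS hScard hSsat using h𝒞.exists_isSaturated hκ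
  have hpt : ∀ F : Set (Set X), ∃ x, (⋂ V ∈ F, closure V).Nonempty → x ∈ ⋂ V ∈ F, closure V := by
    intro F
    by_cases h : (⋂ V ∈ F, closure V).Nonempty
    · exact ⟨h.some, fun _ => h.some_mem⟩
    · exact ⟨Classical.arbitrary X, fun h' => absurd h' h⟩
  choose pt hpt using hpt
  let D : Set (Set X) → Set X := fun 𝒰 => ⋃ F ∈ {F : Set (Set X) | F ⊆ 𝒰 ∧ #F ≤ κ}, S (pt F)
  have hDmono : ∀ {𝒰 𝒱 : Set (Set X)}, 𝒰 ⊆ 𝒱 → D 𝒰 ⊆ D 𝒱 := fun h =>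
    biUnion_mono (fun F hF => ⟨hF.1.trans h, hF.2⟩) fun _ _ => subset_rfl
  have hDcard : ∀ 𝒰 : Set (Set X), #𝒰 ≤ 2 ^ κ → #(D 𝒰) ≤ 2 ^ κ := by
    intro 𝒰 h𝒰
    refine mk_biUnion_le_of_le_of_le hκ2 ((mk_bounded_subset_le 𝒰 κ).trans ?_)
      fun F _ => hScard (pt F)
    calc max #𝒰 ℵ₀ ^ κ ≤ (2 ^ κ) ^ κ := power_le_power_right (max_le h𝒰 hκ2)
      _ = 2 ^ κ := by rw [← power_mul, mul_eq_self hκ]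
  have hg : ∀ 𝒰 : Set (Set X), ∃ V : Set X, #𝒰 ≤ 2 ^ κ →
      IsOpen V ∧ V.Nonempty ∧ Disjoint (closure V) (closure (D 𝒰)) := by
    intro 𝒰
    by_cases h : #𝒰 ≤ 2 ^ κ
    · have hne : (closure (D 𝒰))ᶜ.Nonempty := by
        rw [nonempty_compl]
        exact fun h' => hnd _ (hDcard 𝒰 h) (dense_iff_closure_eq.2 h')
      obtain ⟨V, hVo, hV, hVD⟩ := hqr _ isClosed_closure.isOpen_compl hne
      exact ⟨V, fun _ => ⟨hVo, hV, subset_compl_iff_disjoint_right.1 hVD⟩⟩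
    · exact ⟨∅, fun h' => absurd h' h⟩
  choose g hg using hg
  obtain ⟨V, hV⟩ := exists_eq_apply_image_Iio (ι := lam.ord.ToType) g
  have hVprop : ∀ i, IsOpen (V i) ∧ (V i).Nonempty ∧
      Disjoint (closure (V i)) (closure (D (V '' Iio i))) := by
    intro i
    have hIio : #(Iio i) < lam := by simpa using mk_Iio_lt i (by simp)
    have := hg (V '' Iio i) (mk_image_le.trans
      (Order.lt_succ_iff.1 (hIio.trans_le h2)))
    rwa [← hV i] at this
  obtain ⟨J, hJ, p, hp⟩ := hcal _ V (mk_ord_toType lam) fun i => ⟨(hVprop i).1, (hVprop i).2.1⟩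
  obtain ⟨J₀, hJ₀J, hbdd⟩ := exists_subset_forall_bounded hκ (h1.trans_eq hJ.symm)
  set A : Set X := ⋃ j ∈ J₀, D (V '' Iio j) with hA
  have hAsat : IsSaturated 𝒞 A :=
    .biUnion fun j _ => .biUnion fun F _ => hSsat (pt F)
  have hcov : closure A ⊆ ⋃ j ∈ J₀, (closure (V j))ᶜ := by
    intro x hx
    obtain ⟨B, hBA, hB, hxB⟩ := hAsat.exists_subset_mem_closure h𝒞 hx
    have hidx : ∀ b : B, ∃ j ∈ J₀, (b : X) ∈ D (V '' Iio j) := fun b => by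
      simpa [hA] using hBA b.2
    choose j hjJ hj using hidx
    have hjcard : #(range j) ≤ κ := mk_range_le.trans hB
    obtain ⟨i, hi, hlt⟩ := hbdd (range j) (range_subset_iff.2 hjJ) hjcard
    have hBD : B ⊆ D (V '' Iio i) := by
      intro b hb
      have hlt' : j ⟨b, hb⟩ < i := hlt _ (mem_range_self _)
      exact hDmono (image_mono (Iio_subset_Iio hlt'.le)) (hj ⟨b, hb⟩)
    exact mem_biUnion hi ((hVprop i).2.2.notMem_of_mem_right (closure_mono hBD hxB))
  obtain ⟨K, hKJ, hK, hKcov⟩ := isClosed_closure.exists_subcover_le_lindelofDegree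
    (fun _ _ => isClosed_closure.isOpen_compl) hcov
  obtain ⟨i, hi, hlt⟩ := hbdd K hKJ (hK.trans hLκ)
  have hpK : pt (V '' K) ∈ ⋂ W ∈ V '' K, closure W := by
    refine hpt _ ⟨p, mem_iInter₂.2 ?_⟩
    rintro _ ⟨k, hk, rfl⟩
    exact subset_closure (mem_iInter₂.1 hp k (hJ₀J (hKJ hk)))
  have hpA : pt (V '' K) ∈ A := mem_biUnion hi <|
    mem_biUnion (show V '' K ∈ {F : Set (Set X) | F ⊆ V '' Iio i ∧ #F ≤ κ} from
      ⟨image_mono hlt, mk_image_le.trans (hK.trans hLκ)⟩) (hxS _)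
  obtain ⟨k, hk, hkp⟩ := mem_iUnion₂.1 (hKcov (subset_closure hpA))
  exact hkp (mem_iInter₂.1 hpK _ (mem_image_of_mem V hk))

end
end

section
/- Let X be a quasiregular topological space and let κ = lL(X)·wt(X), where lL(X) is the linear Lindelöf degree of X. If λ is a cardinal that is a caliber of X and satisfies κ < λ ≤ (2^κ)⁺, then d(X) ≤ 2^κ. -/
open Cardinal Set Topology
universe u
noncomputable section

theorem exists_subset_of_tightness_le {Y : Type u} [TopologicalSpace Y] {κ : Cardinal.{u}}
    (h : tightness Y ≤ κ) {A : Set Y} {y : Y} (hy : y ∈ closure A) :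
    ∃ B ⊆ A, #B ≤ κ ∧ y ∈ closure B := by
  have hne : {τ : Cardinal.{u} | ℵ₀ ≤ τ ∧ ∀ (A : Set Y) (y : Y), y ∈ closure A →
      ∃ B ⊆ A, #B ≤ τ ∧ y ∈ closure B}.Nonempty :=
    ⟨max ℵ₀ #Y, le_max_left _ _, fun A _ hy =>
      ⟨A, Subset.rfl, (mk_set_le A).trans (le_max_right _ _), hy⟩⟩
  obtain ⟨B, hBA, hB, hyB⟩ := (csInf_mem hne).2 A y hy
  exact ⟨B, hBA, hB.trans h, hyB⟩

theorem tightness_le_max (Y : Type u) [TopologicalSpace Y] : tightness Y ≤ max ℵ₀ #Y :=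
  csInf_le' ⟨le_max_left _ _, fun A _ hy =>
    ⟨A, Subset.rfl, (mk_set_le A).trans (le_max_right _ _), hy⟩⟩

theorem closure_subset_kClosure {X : Type u} [TopologicalSpace X] {μ : Cardinal.{u}} {A : Set X}
    (hA : #A ≤ μ) : closure A ⊆ kClosure μ A :=
  subset_biUnion_of_mem (u := closure) (show A ∈ {B : Set X | B ⊆ A ∧ #B ≤ μ} from
    ⟨Subset.rfl, hA⟩)

theorem kClosure_mono {X : Type u} [TopologicalSpace X] {μ ν : Cardinal.{u}} (h : μ ≤ ν)
    {A : Set X} : kClosure μ A ⊆ kClosure ν A :=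
  biUnion_subset_biUnion_left fun _ (hB : _ ∧ _) => ⟨hB.1, hB.2.trans h⟩

theorem weakTightness_spec (X : Type u) [TopologicalSpace X] :
    ℵ₀ ≤ weakTightness X ∧ ∃ 𝒞 : Set (Set X), IsWeakTightnessWitness X (weakTightness X) 𝒞 := by
  have hne : {κ : Cardinal.{u} | ℵ₀ ≤ κ ∧
      ∃ 𝒞 : Set (Set X), IsWeakTightnessWitness X κ 𝒞}.Nonempty := by
    refine ⟨max ℵ₀ #X, le_max_left _ _, {Set.univ}, by simp, ?_, ?_⟩
    · rw [mk_singleton]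
      exact Cardinal.one_le_iff_ne_zero.2 (power_ne_zero _ two_ne_zero)
    · rintro C rfl
      refine ⟨by simpa using tightness_le_max (Set.univ : Set X), ?_⟩
      refine univ_subset_iff.1 (subset_closure.trans (closure_subset_kClosure ?_))
      rw [mk_univ]
      exact (le_max_right _ _).trans (cantor _).le
  exact csInf_mem hne

theorem linearLindelofDegree_spec (X : Type u) [TopologicalSpace X] :
    ℵ₀ ≤ linearLindelofDegree X ∧ ∀ 𝒰 : Set (Set X), (∀ U ∈ 𝒰, IsOpen U) →
      IsChain (· ⊆ ·) 𝒰 → ⋃₀ 𝒰 = Set.univ →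
      ∃ 𝒱 ⊆ 𝒰, #𝒱 ≤ linearLindelofDegree X ∧ ⋃₀ 𝒱 = Set.univ := by
  have hne : {κ : Cardinal.{u} | ℵ₀ ≤ κ ∧ ∀ 𝒰 : Set (Set X), (∀ U ∈ 𝒰, IsOpen U) →
      IsChain (· ⊆ ·) 𝒰 → ⋃₀ 𝒰 = Set.univ →
      ∃ 𝒱 ⊆ 𝒰, #𝒱 ≤ κ ∧ ⋃₀ 𝒱 = Set.univ}.Nonempty :=
    ⟨max ℵ₀ #(Set X), le_max_left _ _, fun 𝒰 _ _ h =>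
      ⟨𝒰, Subset.rfl, (mk_set_le 𝒰).trans (le_max_right _ _), h⟩⟩
  exact csInf_mem hne

theorem exists_forall_lt_of_mk_lt_cof {K : Type u} [LinearOrder K] {s : Set K}
    (hs : #s < Order.cof K) : ∃ b, ∀ a ∈ s, a < b := by
  by_contra! h
  exact hs.not_ge (Order.cof_le h)

/-- A decreasing family of nonempty closed sets whose length has cofinality greater than the
linear Lindelöf degree has nonempty intersection. -/
theorem nonempty_iInter_of_linearLindelofDegree_lt_cof {X K : Type u} [TopologicalSpace X]
    [LinearOrder K] (hK : linearLindelofDegree X < Order.cof K) {F : K → Set X}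
    (hF : Antitone F) (hclosed : ∀ k, IsClosed (F k)) (hne : ∀ k, (F k).Nonempty) :
    (⋂ k, F k).Nonempty := by
  by_contra! hempty
  obtain ⟨𝒱, h𝒱, hcard, hcov⟩ := (linearLindelofDegree_spec X).2 (range fun k => (F k)ᶜ)
    (by rintro _ ⟨k, rfl⟩; exact (hclosed k).isOpen_compl)
    (by
      rintro _ ⟨j, rfl⟩ _ ⟨k, rfl⟩ -
      exact (le_total j k).imp (fun h => compl_subset_compl.2 (hF h))
        fun h => compl_subset_compl.2 (hF h))
    (by rw [sUnion_range, ← compl_iInter, hempty, compl_empty])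
  choose g hg using fun V : 𝒱 => h𝒱 V.2
  obtain ⟨b, hb⟩ := exists_forall_lt_of_mk_lt_cof (s := range g)
    ((mk_range_le.trans hcard).trans_lt hK)
  obtain ⟨x, hx⟩ := hne b
  obtain ⟨V, hV, hxV⟩ := hcov.symm ▸ mem_univ x
  have hVx : x ∈ (F (g ⟨V, hV⟩))ᶜ := by simpa only [hg ⟨V, hV⟩] using hxV
  exact hVx (hF (hb _ (mem_range_self _)).le hx)

/-- The closure of the union of a long increasing family is the union of the closures, provided
the union meets every member of a cover by sets of small tightness densely. -/
theorem closure_iUnion_subset_of_tightness_le {X K : Type u} [TopologicalSpace X] [LinearOrder K]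
    {κ : Cardinal.{u}} (hK : κ < Order.cof K) {D : K → Set X} (hD : Monotone D)
    {𝒞 : Set (Set X)} (hcov : ⋃₀ 𝒞 = Set.univ) (htight : ∀ C ∈ 𝒞, tightness C ≤ κ)
    (hsat : ∀ C ∈ 𝒞, ⋃ k, D k ⊆ closure ((⋃ k, D k) ∩ C)) :
    closure (⋃ k, D k) ⊆ ⋃ k, closure (D k) := by
  intro y hy
  obtain ⟨C, hC, hyC⟩ := hcov.symm ▸ mem_univ y
  have hy' : (⟨y, hyC⟩ : C) ∈ closure (Subtype.val ⁻¹' ⋃ k, D k) := by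
    rw [closure_subtype, Subtype.image_preimage_coe, inter_comm]
    exact closure_minimal (hsat C hC) isClosed_closure hy
  obtain ⟨B, hBD, hB, hyB⟩ := exists_subset_of_tightness_le (htight C hC) hy'
  choose g hg using fun b : B => mem_iUnion.1 (hBD b.2)
  obtain ⟨k, hk⟩ := exists_forall_lt_of_mk_lt_cof (s := range g)
    ((mk_range_le.trans hB).trans_lt hK)
  refine mem_iUnion.2 ⟨k, closure_mono ?_ (closure_subtype.1 hyB)⟩
  rintro _ ⟨b, hb, rfl⟩
  exact hD (hk _ (mem_range_self ⟨b, hb⟩)).le (hg ⟨b, hb⟩)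

theorem mk_biUnion_le_of_le {ι α : Type u} {s : Set ι} {A : ι → Set α} {c : Cardinal.{u}}
    (hc : ℵ₀ ≤ c) (hs : #s ≤ c) (hA : ∀ i ∈ s, #(A i) ≤ c) : #(⋃ i ∈ s, A i) ≤ c :=
  (mk_biUnion_le A s).trans <|
    (mul_le_mul' hs (ciSup_le' fun i : s => hA i.1 i.2)).trans (mul_eq_self hc).le

/-- Each point lies in the closure of the trace on every member of a weak tightness witness of a
single set of size at most `2 ^ κ`. -/
theorem exists_small_saturating {X : Type u} [TopologicalSpace X] {κ : Cardinal.{u}}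
    (hκ : ℵ₀ ≤ κ) {𝒞 : Set (Set X)} (h𝒞 : #𝒞 ≤ 2 ^ κ)
    (hcl : ∀ C ∈ 𝒞, kClosure (2 ^ κ) C = Set.univ) (x : X) :
    ∃ S : Set X, #S ≤ 2 ^ κ ∧ x ∈ S ∧ ∀ C ∈ 𝒞, x ∈ closure (S ∩ C) := by
  have hinf : ℵ₀ ≤ 2 ^ κ := hκ.trans (cantor κ).le
  have hB : ∀ C : Set X, ∃ B : Set X, C ∈ 𝒞 → (B ⊆ C ∧ #B ≤ 2 ^ κ) ∧ x ∈ closure B := by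
    intro C
    by_cases hC : C ∈ 𝒞
    · have hx : x ∈ kClosure (2 ^ κ) C := hcl C hC ▸ mem_univ x
      obtain ⟨B, hB, hxB⟩ := mem_iUnion₂.1 hx
      exact ⟨B, fun _ => ⟨hB, hxB⟩⟩
    · exact ⟨∅, fun h => absurd h hC⟩
  choose B hB using hB
  refine ⟨insert x (⋃ C ∈ 𝒞, B C), ?_, mem_insert _ _, fun C hC => ?_⟩
  · refine mk_insert_le.trans (add_le_of_le hinf ?_ (one_le_aleph0.trans hinf))
    exact mk_biUnion_le_of_le hinf h𝒞 fun C hC => (hB C hC).1.2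
  · exact closure_mono (subset_inter ((subset_biUnion_of_mem (u := B) hC).trans
      (subset_insert _ _)) (hB C hC).1.1) (hB C hC).2

/-- All values of `q` on subfamilies of `𝒟` of size at most `κ`, together with all `S x` for `x`
in a member of `𝒟`. -/
def closureStep {X : Type u} (κ : Cardinal.{u}) (q : Set (Set X) → X) (S : X → Set X)
    (𝒟 : Set (Set X)) : Set X :=
  q '' {ℰ | ℰ ⊆ 𝒟 ∧ #ℰ ≤ κ} ∪ ⋃ E ∈ 𝒟, ⋃ x ∈ E, S x

theorem mk_closureStep_le {X : Type u} {κ : Cardinal.{u}} (hκ : ℵ₀ ≤ κ) {q : Set (Set X) → X}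
    {S : X → Set X} (hS : ∀ x, #(S x) ≤ 2 ^ κ) {𝒟 : Set (Set X)} (h𝒟 : #𝒟 ≤ 2 ^ κ)
    (hmem : ∀ E ∈ 𝒟, #E ≤ 2 ^ κ) : #(closureStep κ q S 𝒟) ≤ 2 ^ κ := by
  have hinf : ℵ₀ ≤ 2 ^ κ := hκ.trans (cantor κ).le
  refine (mk_union_le _ _).trans (add_le_of_le hinf (mk_image_le.trans ?_) ?_)
  · refine (mk_bounded_subset_le 𝒟 κ).trans ((power_le_power_right (max_le h𝒟 hinf)).trans ?_)
    rw [← power_mul, mul_eq_self hκ]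
  · exact mk_biUnion_le_of_le hinf h𝒟 fun E hE =>
      mk_biUnion_le_of_le hinf (hmem E hE) fun x _ => hS x

theorem exists_eq_image_Iio {ι α : Type u} [Preorder ι] [WellFoundedLT ι] (Ψ : Set α → α) :
    ∃ D : ι → α, ∀ i, D i = Ψ (D '' Iio i) := by
  refine ⟨(wellFounded_lt (α := ι)).fix fun i rec => Ψ {E | ∃ j, ∃ h : j < i, rec j h = E},
    fun i => ?_⟩
  rw [WellFounded.fix_eq]
  congr 1
  ext E
  simp

theorem mk_Iio_le_of_le_succ {c μ : Cardinal.{u}} (h : c ≤ Order.succ μ) (i : c.ord.ToType) :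
    #(Iio i) ≤ μ := by
  have hi := mk_Iio_lt i (by simp)
  rw [mk_ord_toType] at hi
  exact Order.lt_succ_iff.1 (hi.trans_le h)

theorem exists_strictMono_of_le_mk {μ : Cardinal.{u}} {ι : Type u} [LinearOrder ι]
    [WellFoundedLT ι] {J : Set ι} (hJ : μ ≤ #J) :
    ∃ f : μ.ord.ToType → ι, StrictMono f ∧ ∀ k, f k ∈ J := by
  have h : Ordinal.type (α := μ.ord.ToType) (· < ·) ≤ Ordinal.type (α := J) (· < ·) := by
    rw [Ordinal.type_toType]
    exact (ord_le_ord.2 hJ).trans (ord_le_type _)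
  obtain ⟨g⟩ := Ordinal.type_le_iff'.1 h
  exact ⟨fun k => g k, fun _ _ hjk => g.map_rel_iff.2 hjk, fun k => (g k).2⟩

/-- A quasiregular space with linear Lindelöf degree at most `κ`, a weak tightness witness for `κ`
and a caliber in `(κ, (2 ^ κ)⁺]` has a dense set of size at most `2 ^ κ`. -/
theorem exists_dense_of_isCaliber {X : Type u} [TopologicalSpace X] (hqr : Quasiregular X)
    {κ lam : Cardinal.{u}} (hκ : ℵ₀ ≤ κ) (hL : linearLindelofDegree X ≤ κ) {𝒞 : Set (Set X)}
    (hcov : ⋃₀ 𝒞 = Set.univ) (h𝒞 : #𝒞 ≤ 2 ^ κ) (htight : ∀ C ∈ 𝒞, tightness C ≤ κ)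
    (hcl : ∀ C ∈ 𝒞, kClosure (2 ^ κ) C = Set.univ) (hcal : IsCaliber X lam) (h1 : κ < lam)
    (h2 : lam ≤ Order.succ (2 ^ κ)) : ∃ D : Set X, Dense D ∧ #D ≤ 2 ^ κ := by
  by_contra! hdense
  have hpick : ∀ E : Set X, ∃ V : Set X, #E ≤ 2 ^ κ →
      (IsOpen V ∧ V.Nonempty) ∧ Disjoint (closure V) (closure E) := by
    intro E
    by_cases hE : #E ≤ 2 ^ κ
    · have hne : (closure E)ᶜ.Nonempty := by
        rw [nonempty_compl, Ne, ← dense_iff_closure_eq]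
        exact fun h => (hdense E h).not_ge hE
      obtain ⟨V, hVo, hVne, hV⟩ := hqr _ isClosed_closure.isOpen_compl hne
      exact ⟨V, fun _ => ⟨⟨hVo, hVne⟩, disjoint_left.2 hV⟩⟩
    · exact ⟨∅, fun h => absurd h hE⟩
  choose V hV using hpick
  have : Nonempty X := (hV ∅ (by simp)).1.2.to_type
  have hq : ∀ ℰ : Set (Set X), ∃ p : X, (⋂ E ∈ ℰ, closure (V E)).Nonempty →
      p ∈ ⋂ E ∈ ℰ, closure (V E) := fun ℰ => by
    by_cases h : (⋂ E ∈ ℰ, closure (V E)).Nonempty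
    · exact h.imp fun p hp _ => hp
    · exact ⟨Classical.arbitrary X, fun h' => absurd h' h⟩
  choose q hq using hq
  choose S hScard hSmem hS using exists_small_saturating hκ h𝒞 hcl
  obtain ⟨D, hD⟩ := exists_eq_image_Iio (ι := lam.ord.ToType) (closureStep κ q S)
  have hDcard : ∀ i, #(D i) ≤ 2 ^ κ := fun i => by
    induction i using WellFoundedLT.induction with
    | ind i ih =>
      rw [hD i]
      refine mk_closureStep_le hκ hScard (mk_image_le.trans ?_) ?_
      · exact mk_Iio_le_of_le_succ h2 i
      · rintro _ ⟨j, hj, rfl⟩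
        exact ih j hj
  have hSD : ∀ {i j}, i < j → ∀ x ∈ D i, S x ⊆ D j := fun {i j} hij x hx => by
    rw [hD j]
    exact (subset_biUnion_of_mem (u := S) hx).trans <|
      (subset_biUnion_of_mem (u := fun E => ⋃ x ∈ E, S x) (mem_image_of_mem D (mem_Iio.2 hij))).trans
        subset_union_right
  obtain ⟨J, hJ, x, hx⟩ := hcal _ (fun i => V (D i)) (mk_ord_toType lam)
    fun i => (hV _ (hDcard i)).1
  obtain ⟨f, hf, hfJ⟩ := exists_strictMono_of_le_mk (μ := Order.succ κ) (J := J)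
    (hJ.symm ▸ Order.succ_le_of_lt h1 :)
  have hreg : κ < Order.cof (Order.succ κ).ord.ToType := by
    rw [Ordinal.cof_toType, (isRegular_succ hκ).cof_ord]
    exact Order.lt_succ κ
  have : NoMaxOrder (Order.succ κ).ord.ToType := Cardinal.noMaxOrder (hκ.trans (Order.le_succ κ))
  have : Nonempty (Order.succ κ).ord.ToType := by
    rw [← mk_ne_zero_iff, mk_ord_toType]
    exact (isRegular_succ hκ).ne_zero
  let p := fun k => q (D '' (f '' Iio k))
  have hpD : ∀ k, p k ∈ D (f k) := fun k => by
    rw [hD (f k)]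
    refine Or.inl (mem_image_of_mem q ⟨image_mono ?_, mk_image_le.trans (mk_image_le.trans ?_)⟩)
    · rintro _ ⟨j, hj, rfl⟩
      exact hf hj
    · exact mk_Iio_le_of_le_succ le_rfl k
  have hpV : ∀ {j k}, j < k → p k ∈ closure (V (D (f j))) := fun {j k} hjk => by
    have hmem := hq (D '' (f '' Iio k)) ⟨x, mem_iInter₂.2 ?_⟩
    · exact mem_iInter₂.1 hmem _ (mem_image_of_mem D (mem_image_of_mem f hjk))
    · rintro _ ⟨_, ⟨i, -, rfl⟩, rfl⟩
      exact subset_closure (mem_iInter₂.1 hx _ (hfJ i))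
  obtain ⟨y, hy⟩ := nonempty_iInter_of_linearLindelofDegree_lt_cof (hL.trans_lt hreg)
    (F := fun k => closure (p '' Ioi k))
    (fun j k hjk => closure_mono (image_mono (Ioi_subset_Ioi hjk))) (fun _ => isClosed_closure)
    fun k => (nonempty_Ioi.image p).closure
  rw [mem_iInter] at hy
  have hmono : Monotone fun k => D (f k) := monotone_iff_forall_lt.2 fun j k hjk x hx =>
    hSD (hf hjk) x hx (hSmem x)
  have hyD : y ∈ closure (⋃ k, D (f k)) := by
    refine closure_mono ?_ (hy (Classical.arbitrary _))
    rintro _ ⟨k, -, rfl⟩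
    exact mem_iUnion.2 ⟨k, hpD k⟩
  have hsat : ∀ C ∈ 𝒞, ⋃ k, D (f k) ⊆ closure ((⋃ k, D (f k)) ∩ C) := by
    refine fun C hC => iUnion_subset fun k z hz => closure_mono ?_ (hS z C hC)
    obtain ⟨l, hkl⟩ := exists_gt k
    exact inter_subset_inter_left _ ((hSD (hf hkl) z hz).trans
      (subset_iUnion (fun k => D (f k)) l))
  obtain ⟨b, hb⟩ := mem_iUnion.1
    (closure_iUnion_subset_of_tightness_le hreg hmono hcov htight hsat hyD)
  refine disjoint_left.1 (hV _ (hDcard (f b))).2 (closure_minimal ?_ isClosed_closure (hy b)) hb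
  rintro _ ⟨k, hk, rfl⟩
  exact hpV hk

/-- If `X` is quasiregular, `κ = lL(X)·wt(X)`, and `λ` is a caliber of `X`
with `κ < λ ≤ (2^κ)⁺`, then `d(X) ≤ 2^κ`. -/
theorem density_le_of_caliber_linearLindelof (X : Type u) [TopologicalSpace X]
    (hqr : Quasiregular X) (lam : Cardinal.{u}) (hcal : IsCaliber X lam)
    (h1 : linearLindelofDegree X * weakTightness X < lam)
    (h2 : lam ≤ Order.succ (2 ^ (linearLindelofDegree X * weakTightness X))) :
    density X ≤ 2 ^ (linearLindelofDegree X * weakTightness X) := by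
  obtain ⟨hW, 𝒞, hcov, h𝒞, hC⟩ := weakTightness_spec X
  have hL := (linearLindelofDegree_spec X).1
  set κ := linearLindelofDegree X * weakTightness X with hκ_def
  have hLκ : linearLindelofDegree X ≤ κ := le_mul_right (aleph0_pos.trans_le hW).ne'
  have hWκ : weakTightness X ≤ κ := le_mul_left (aleph0_pos.trans_le hL).ne'
  have hκ : ℵ₀ ≤ κ := hL.trans hLκ
  have hpow : (2 : Cardinal.{u}) ^ weakTightness X ≤ 2 ^ κ := power_le_power_left two_ne_zero hWκ
  obtain ⟨D, hD, hDcard⟩ := exists_dense_of_isCaliber hqr hκ hLκ hcov (h𝒞.trans hpow)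
    (fun C hCmem => (hC C hCmem).1.trans hWκ)
    (fun C hCmem => univ_subset_iff.1 <| (hC C hCmem).2.symm.subset.trans
      (kClosure_mono hpow)) hcal h1 h2
  exact csInf_le' ⟨hκ.trans (cantor κ).le, D, hD, hDcard⟩

end
end
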